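/- For 1 ≤ k ≤ n, the number of standard composite set partitions of {1,…,n} consisting of exactly k ordered set partitions equals ∑_{i=k}^{n} S(n,i)·s(i,k). -/

import Mathlib

open scoped Pointwise Classical

namespace PlatesPaper

/-- The union of a list of finite sets. -/
def lUnion {n : ℕ} (L : List (Finset (Fin n))) : Finset (Fin n) :=
  L.foldr (· ∪ ·) ∅

/-- `L` is an ordered set partition of `J`: a list of pairwise disjoint nonempty
finite sets whose union is `J`. -/
def IsOSP {n : ℕ} (J : Finset (Fin n)) (L : List (Finset (Fin n))) : Prop :=
  (∀ B ∈ L, B.Nonempty) ∧ L.Pairwise Disjoint ∧ lUnion L = J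

/-- The plate of an ordered set partition `L` (of a subset `J = lUnion L` of `{1,…,n}`):
the set of `x ∈ V₀ⁿ` vanishing outside `J`, with `x_J = 0`, and such that the partial
sums over the unions of the first `i` blocks are nonnegative for `i = 1,…,len(L)−1`.
(For an ordered set partition of the whole of `{1,…,n}` the first two conditions are
equivalent to `x ∈ V₀ⁿ`.) -/
def plate {n : ℕ} (L : List (Finset (Fin n))) : Set (Fin n → ℝ) :=
  {x | (∑ i, x i = 0) ∧ (∀ j, j ∉ lUnion L → x j = 0) ∧ (∑ j ∈ lUnion L, x j = 0) ∧
    ∀ i : ℕ, 0 < i → i < L.length → 0 ≤ ∑ j ∈ lUnion (L.take i), x j}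

/-- `ℚ`-valued indicator function of a set of points of `ℝⁿ`. -/
noncomputable def ind {n : ℕ} (S : Set (Fin n → ℝ)) : (Fin n → ℝ) → ℚ :=
  fun x => if x ∈ S then 1 else 0

/-- The index of the block of `L` containing the element `a`. -/
def blockIdx {n : ℕ} (L : List (Finset (Fin n))) (a : Fin n) : ℕ :=
  L.findIdx fun B => decide (a ∈ B)

/-- The index of the block of `L` containing the set `B`. -/
def subIdx {n : ℕ} (L : List (Finset (Fin n))) (B : Finset (Fin n)) : ℕ :=
  L.findIdx fun C => decide (B ⊆ C)

/-- `B` is contained in one of the blocks of `L`. -/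
def memBlock {n : ℕ} (L : List (Finset (Fin n))) (B : Finset (Fin n)) : Prop :=
  ∃ j < L.length, B ⊆ L.getD j ∅

/-- `F` is a standard composite set partition of `{1,…,n}`: an (unordered, finite)
collection of ordered set partitions of pairwise disjoint nonempty subsets of `{1,…,n}`
whose union is `{1,…,n}`, such that the first block of each member contains the minimum
of its underlying set. -/
def IsStdCSP (n : ℕ) (F : Finset (List (Finset (Fin n)))) : Prop :=
  (∀ M ∈ F, IsOSP (lUnion M) M ∧ M ≠ []) ∧
  ((F : Set (List (Finset (Fin n)))).Pairwise fun M M' => Disjoint (lUnion M) (lUnion M')) ∧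
  F.sup lUnion = Finset.univ ∧
  (∀ M ∈ F, ∃ b ∈ M.headD ∅, ∀ a ∈ lUnion M, b ≤ a)

/-- Stirling numbers of the second kind. -/
def stirling2 : ℕ → ℕ → ℕ
  | 0, 0 => 1
  | 0, _ + 1 => 0
  | _ + 1, 0 => 0
  | n + 1, k + 1 => (k + 1) * stirling2 n (k + 1) + stirling2 n k

/-- Unsigned Stirling numbers of the first kind. -/
def stirling1 : ℕ → ℕ → ℕ
  | 0, 0 => 1
  | 0, _ + 1 => 0
  | _ + 1, 0 => 0
  | n + 1, k + 1 => n * stirling1 n (k + 1) + stirling1 n k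


abbrev Blk (n : ℕ) := Finset (Fin n)

theorem mem_lUnion {n : ℕ} (L : List (Blk n)) (x : Fin n) :
    x ∈ lUnion L ↔ ∃ B ∈ L, x ∈ B := by
  induction L with
  | nil => simp [lUnion]
  | cons a t ih =>
    have : lUnion (a :: t) = a ∪ lUnion t := rfl
    simp [this, ih]

/-- A standard nonempty ordered set partition (of its union). -/
def Q {n : ℕ} (M : List (Blk n)) : Prop :=
  (∀ B ∈ M, B.Nonempty) ∧ M.Pairwise Disjoint ∧ M ≠ [] ∧
    ∃ b ∈ M.headD ∅, ∀ a ∈ lUnion M, b ≤ a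

/-- Standard composite set partition of `U`. -/
def Csp {n : ℕ} (U : Blk n) (F : Finset (List (Blk n))) : Prop :=
  (∀ M ∈ F, Q M) ∧
  ((F : Set (List (Blk n))).Pairwise fun M M' => Disjoint (lUnion M) (lUnion M')) ∧
  F.sup lUnion = U

theorem csp_iff {n : ℕ} (F : Finset (List (Blk n))) :
    IsStdCSP n F ↔ Csp Finset.univ F := by
  unfold IsStdCSP Csp Q IsOSP
  constructor
  · rintro ⟨h1, h2, h3, h4⟩
    exact ⟨fun M hM => ⟨(h1 M hM).1.1, (h1 M hM).1.2.1, (h1 M hM).2, h4 M hM⟩, h2, h3⟩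
  · rintro ⟨h1, h2, h3⟩
    exact ⟨fun M hM => ⟨⟨(h1 M hM).1, (h1 M hM).2.1, rfl⟩, (h1 M hM).2.2.1⟩, h2, h3,
      fun M hM => (h1 M hM).2.2.2⟩

theorem Q.lne {n : ℕ} {M : List (Blk n)} (h : Q M) : (lUnion M).Nonempty := by
  obtain ⟨h1, -, h3, -⟩ := h
  cases M with
  | nil => exact absurd rfl h3
  | cons a t =>
    obtain ⟨x, hx⟩ := h1 a (by simp)
    exact ⟨x, (mem_lUnion _ _).2 ⟨a, by simp, hx⟩⟩

theorem Q.nodup {n : ℕ} {M : List (Blk n)} (h : Q M) : M.Nodup := by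
  obtain ⟨h1, h2, -, -⟩ := h
  refine (List.Pairwise.and_mem.1 h2).imp ?_
  rintro a b ⟨ha, hb, hd⟩ rfl
  exact (h1 a ha).ne_empty (by simpa using hd)

theorem Csp.not_mem {n : ℕ} {U : Blk n} {M : List (Blk n)} {F : Finset (List (Blk n))}
    (hQ : Q M) (h : Csp (U \ lUnion M) F) : M ∉ F := by
  intro hM
  obtain ⟨x, hx⟩ := hQ.lne
  have : x ∈ U \ lUnion M := by
    rw [← h.2.2]; exact Finset.mem_sup.2 ⟨M, hM, hx⟩
  simp [hx] at this

theorem Csp.insert {n : ℕ} {U : Blk n} {M : List (Blk n)} {F : Finset (List (Blk n))}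
    (hQ : Q M) (hU : lUnion M ⊆ U) (h : Csp (U \ lUnion M) F) : Csp U (insert M F) := by
  obtain ⟨h1, h2, h3⟩ := h
  have key : ∀ M' ∈ F, Disjoint (lUnion M) (lUnion M') := by
    intro M' hM'
    have : lUnion M' ⊆ U \ lUnion M := by
      rw [← h3]; exact Finset.le_sup (f := lUnion) hM'
    exact (Finset.disjoint_sdiff).mono_right this
  refine ⟨?_, ?_, ?_⟩
  · intro M' hM'
    rcases Finset.mem_insert.1 hM' with rfl | h
    · exact hQ
    · exact h1 _ h
  · rw [Finset.coe_insert]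
    refine h2.insert ?_
    intro b hb _
    exact ⟨key b hb, (key b hb).symm⟩
  · rw [Finset.sup_insert, h3]
    exact Finset.union_sdiff_of_subset hU

theorem Csp.erase {n : ℕ} {U : Blk n} {M : List (Blk n)} {F : Finset (List (Blk n))}
    (h : Csp U F) (hM : M ∈ F) : Q M ∧ lUnion M ⊆ U ∧ Csp (U \ lUnion M) (F.erase M) := by
  obtain ⟨h1, h2, h3⟩ := h
  refine ⟨h1 M hM, ?_, ?_, ?_, ?_⟩
  · rw [← h3]; exact Finset.le_sup (f := lUnion) hM
  · intro M' h'; exact h1 _ (Finset.mem_of_mem_erase h')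
  · exact h2.mono (by simp)
  · ext x
    rw [← h3]
    simp only [Finset.mem_sup, Finset.mem_erase, Finset.mem_sdiff]
    constructor
    · rintro ⟨M', ⟨hne, hM'⟩, hx⟩
      exact ⟨⟨M', hM', hx⟩, fun hx' =>
        Finset.disjoint_left.1 (h2 hM hM' (Ne.symm hne)) hx' hx⟩
    · rintro ⟨⟨M', hM', hx⟩, hx'⟩
      exact ⟨M', ⟨by rintro rfl; exact hx' hx, hM'⟩, hx⟩

abbrev PT (n : ℕ) := List (Blk n) × Blk n × List (Blk n) × Finset (List (Blk n))

/-- The list of a pointed structure. -/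
def lst {n : ℕ} (p : PT n) : List (Blk n) := p.1 ++ p.2.1 :: p.2.2.1

def base {n : ℕ} (p : PT n) : Finset (List (Blk n)) := insert (lst p) p.2.2.2

def IsPt {n : ℕ} (U : Blk n) (p : PT n) : Prop :=
  Q (lst p) ∧ lUnion (lst p) ⊆ U ∧ Csp (U \ lUnion (lst p)) p.2.2.2

theorem finite_nodup (n : ℕ) : {M : List (Blk n) | M.Nodup}.Finite := by
  refine (List.finite_length_le (Blk n) (Fintype.card (Blk n))).subset ?_
  intro M hM
  exact List.Nodup.length_le_card hM

theorem finite_fam (n : ℕ) :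
    {F : Finset (List (Blk n)) | ∀ M ∈ F, M.Nodup}.Finite := by
  refine ((finite_nodup n).toFinset.powerset.finite_toSet).subset ?_
  intro F hF
  simp only [Finset.coe_powerset, Set.mem_preimage, Set.mem_powerset_iff]
  intro M hM
  simpa using hF M hM

theorem finite_csp {n : ℕ} (U : Blk n) : {F | Csp U F}.Finite :=
  (finite_fam n).subset fun _ hF M hM => (hF.1 M hM).nodup

theorem finite_pt {n : ℕ} (U : Blk n) : {p : PT n | IsPt U p}.Finite := by
  refine ((finite_nodup n).prod ((Set.finite_univ (α := Blk n)).prod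
    ((finite_nodup n).prod (finite_fam n)))).subset ?_
  rintro ⟨l1, b, l2, F⟩ ⟨h1, -, h3⟩
  have := h1.nodup
  simp only [lst, List.nodup_append, List.nodup_cons] at this
  exact ⟨this.1, trivial, this.2.1.2, fun M hM => (h3.1 M hM).nodup⟩

noncomputable def cspF {n : ℕ} (U : Blk n) : Finset (Finset (List (Blk n))) :=
  (finite_csp U).toFinset

noncomputable def ptF {n : ℕ} (U : Blk n) : Finset (PT n) := (finite_pt U).toFinset

theorem mem_cspF {n : ℕ} {U : Blk n} {F} : F ∈ cspF U ↔ Csp U F := by simp [cspF]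

theorem mem_ptF {n : ℕ} {U : Blk n} {p} : p ∈ ptF U ↔ IsPt U p := by simp [ptF]

/-- The number of blocks. -/
def nb {n : ℕ} (F : Finset (List (Blk n))) : ℕ := ∑ M ∈ F, M.length

theorem IsPt.not_mem {n : ℕ} {U : Blk n} {p : PT n} (h : IsPt U p) : lst p ∉ p.2.2.2 :=
  Csp.not_mem h.1 h.2.2

theorem IsPt.base {n : ℕ} {U : Blk n} {p : PT n} (h : IsPt U p) : Csp U (base p) :=
  Csp.insert h.1 h.2.1 h.2.2

theorem IsPt.nb {n : ℕ} {U : Blk n} {p : PT n} (h : IsPt U p) :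
    nb (PlatesPaper.base p) = p.1.length + p.2.2.1.length + 1 + nb p.2.2.2 := by
  unfold PlatesPaper.nb PlatesPaper.base
  rw [Finset.sum_insert h.not_mem]
  simp [lst]; omega

theorem IsPt.card {n : ℕ} {U : Blk n} {p : PT n} (h : IsPt U p) :
    (PlatesPaper.base p).card = p.2.2.2.card + 1 := by
  unfold PlatesPaper.base
  rw [Finset.card_insert_of_notMem h.not_mem]

/-- Counting pointed structures. -/
theorem sum_pt {n : ℕ} (U : Blk n) (f : Finset (List (Blk n)) → ℕ) :
    ∑ p ∈ ptF U, f (base p) = ∑ G ∈ cspF U, nb G * f G := by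
  have h1 : ∀ G ∈ cspF U, nb G * f G =
      ∑ x ∈ G.sigma (fun M => Finset.range M.length), f G := by
    intro G _
    rw [Finset.sum_const, Finset.card_sigma, smul_eq_mul]
    simp [nb]
  rw [Finset.sum_congr rfl h1, Finset.sum_sigma']
  symm
  refine Finset.sum_bij' (fun x _ => (x.2.1.take x.2.2, x.2.1.getD x.2.2 ∅,
      x.2.1.drop (x.2.2 + 1), x.1.erase x.2.1))
    (fun p _ => ⟨base p, lst p, p.1.length⟩) ?_ ?_ ?_ ?_ ?_
  · rintro ⟨G, M, j⟩ h
    simp only [Finset.mem_sigma, Finset.mem_range, mem_cspF] at h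
    obtain ⟨hG, hM, hj⟩ := h
    have : M.take j ++ M.getD j ∅ :: M.drop (j+1) = M := by
      rw [List.getD_eq_getElem _ _ hj, ← List.drop_eq_getElem_cons hj, List.take_append_drop]
    rw [mem_ptF]
    simp only [IsPt, lst, this]
    exact hG.erase hM
  · intro p hp
    rw [mem_ptF] at hp
    simp only [Finset.mem_sigma, Finset.mem_range, mem_cspF]
    exact ⟨hp.base, by simp [base], by simp [lst]⟩
  · rintro ⟨G, M, j⟩ h
    simp only [Finset.mem_sigma, Finset.mem_range, mem_cspF] at h
    obtain ⟨hG, hM, hj⟩ := h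
    have : M.take j ++ M.getD j ∅ :: M.drop (j+1) = M := by
      rw [List.getD_eq_getElem _ _ hj, ← List.drop_eq_getElem_cons hj, List.take_append_drop]
    simp [base, lst, this, Finset.insert_erase hM, -List.getD_eq_getElem?_getD]
    omega
  · rintro ⟨l1, b, l2, F⟩ hp
    rw [mem_ptF] at hp
    have := hp.not_mem
    simp only [lst] at this
    simp [base, lst, this]
  · rintro ⟨G, M, j⟩ h
    simp only [Finset.mem_sigma, Finset.mem_range, mem_cspF] at h
    obtain ⟨hG, hM, hj⟩ := h
    have : M.take j ++ M.getD j ∅ :: M.drop (j+1) = M := by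
      rw [List.getD_eq_getElem _ _ hj, ← List.drop_eq_getElem_cons hj, List.take_append_drop]
    simp [base, lst, this, Finset.insert_erase hM, -List.getD_eq_getElem?_getD]

/-- Each CSP of a set containing `e` is uniquely pointed at `e`. -/
theorem sum_point {n : ℕ} (U : Blk n) (e : Fin n) (he : e ∈ U)
    (f : Finset (List (Blk n)) → ℕ) :
    ∑ F ∈ cspF U, f F = ∑ p ∈ (ptF U).filter (fun p => e ∈ p.2.1), f (base p) := by
  symm
  refine Finset.sum_bij (fun p _ => base p) ?_ ?_ ?_ (fun _ _ => rfl)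
  · intro p hp
    rw [Finset.mem_filter, mem_ptF] at hp
    exact mem_cspF.2 hp.1.base
  · intro p hp q hq hpq
    rw [Finset.mem_filter, mem_ptF] at hp hq
    have hl : lst p = lst q := by
      have hm : lst q ∈ base p := by rw [hpq]; simp [base]
      have hm' : lst p ∈ base p := by simp [base]
      by_contra hne
      have hd : Disjoint (lUnion (lst p)) (lUnion (lst q)) := hp.1.base.2.1 hm' hm hne
      refine absurd ?_ ((Finset.disjoint_left.1 hd : ∀ ⦃a⦄, _ → _) (?_ : e ∈ _))
      rotate_left
      · exact (mem_lUnion _ _).2 ⟨p.2.1, by simp [lst], hp.2⟩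
      · exact (mem_lUnion _ _).2 ⟨q.2.1, by simp [lst], hq.2⟩
    have hF : p.2.2.2 = q.2.2.2 := by
      rw [← Finset.erase_insert hp.1.not_mem, ← Finset.erase_insert hq.1.not_mem, ← hl]
      congr 1
      simpa [base, ← hl] using hpq
    have hdp := hp.1.1.2.1
    have hdq := hq.1.1.2.1
    have hep := hp.2
    have heq := hq.2
    clear hpq
    obtain ⟨l1, b, l2, F⟩ := p
    obtain ⟨l1', b', l2', F'⟩ := q
    simp only [lst] at hl hdp hdq hF hep heq
    subst hF
    clear hp hq
    have : l1 = l1' ∧ b = b' ∧ l2 = l2' := by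
      induction l1 generalizing l1' with
      | nil =>
        cases l1' with
        | nil => simpa using hl
        | cons a t =>
          exfalso
          simp only [List.nil_append, List.cons_append, List.cons.injEq] at hl
          obtain ⟨rfl, rfl⟩ := hl
          simp only [List.cons_append, List.pairwise_cons] at hdq
          exact Finset.disjoint_left.1 (hdq.1 b' (by simp)) hep heq
      | cons a t ih =>
        cases l1' with
        | nil =>
          exfalso
          simp only [List.nil_append, List.cons_append, List.cons.injEq] at hl
          obtain ⟨rfl, rfl⟩ := hl
          simp only [List.cons_append, List.pairwise_cons] at hdp
          exact Finset.disjoint_left.1 (hdp.1 b (by simp)) heq hep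
        | cons a' t' =>
          simp only [List.cons_append, List.cons.injEq] at hl
          simp only [List.cons_append, List.pairwise_cons] at hdp hdq
          obtain ⟨h1, h2, h3⟩ := ih hdp.2 t' hdq.2 hl.2
          exact ⟨by rw [hl.1, h1], h2, h3⟩
    obtain ⟨rfl, rfl, rfl⟩ := this
    rfl
  · intro F hF
    rw [mem_cspF] at hF
    have he' := he
    rw [← hF.2.2, Finset.mem_sup] at he'
    obtain ⟨M, hM, heM⟩ := he'
    obtain ⟨B, hB, heB⟩ := (mem_lUnion _ _).1 heM
    obtain ⟨l1, l2, hl⟩ := List.append_of_mem hB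
    refine ⟨(l1, B, l2, F.erase M), ?_, ?_⟩
    · rw [Finset.mem_filter, mem_ptF]
      refine ⟨?_, heB⟩
      simp only [IsPt, lst, ← hl]
      exact hF.erase hM
    · simp only [base, lst, ← hl]
      exact Finset.insert_erase hM


theorem lU_app {n : ℕ} (l1 l2 : List (Blk n)) (B : Blk n) :
    lUnion (l1 ++ B :: l2) = lUnion l1 ∪ (B ∪ lUnion l2) := by
  ext x
  simp [mem_lUnion, or_and_right, exists_or]

theorem lU_snoc {n : ℕ} (l1 : List (Blk n)) (B : Blk n) :
    lUnion (l1 ++ [B]) = lUnion l1 ∪ B := by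
  rw [lU_app]; simp [lUnion]

theorem headD_app {n : ℕ} (l1 l2 : List (Blk n)) (B : Blk n) :
    (l1 ++ B :: l2).headD ∅ = l1.headD B := by
  cases l1 <;> rfl

theorem disj_lU {n : ℕ} (l : List (Blk n)) (B : Blk n) :
    Disjoint B (lUnion l) ↔ ∀ A ∈ l, Disjoint B A := by
  simp only [Finset.disjoint_left, mem_lUnion]
  constructor
  · intro h A hA x hx hx'
    exact h hx ⟨A, hA, hx'⟩
  · rintro h x hx ⟨A, hA, hx'⟩
    exact h A hA hx hx'

theorem pw_iff {n : ℕ} (l1 l2 : List (Blk n)) (B : Blk n) :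
    (l1 ++ B :: l2).Pairwise Disjoint ↔ l1.Pairwise Disjoint ∧ l2.Pairwise Disjoint ∧
      Disjoint B (lUnion l2) ∧ Disjoint B (lUnion l1) ∧ Disjoint (lUnion l2) (lUnion l1) := by
  rw [List.pairwise_append, List.pairwise_cons, disj_lU, disj_lU, disj_lU]
  simp only [List.mem_cons, forall_eq_or_imp]
  constructor
  · rintro ⟨h1, ⟨h2, h3⟩, h4⟩
    refine ⟨h1, h3, h2, fun A hA => (h4 A hA).1.symm, fun A hA => ?_⟩
    exact ((disj_lU _ _).2 (h4 A hA).2).symm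
  · rintro ⟨h1, h2, h3, h4, h5⟩
    refine ⟨h1, ⟨h3, h2⟩, fun A hA => ⟨(h4 A hA).symm, ?_⟩⟩
    exact (disj_lU _ _).1 (h5 A hA).symm

theorem Q_iff {n : ℕ} (l1 l2 : List (Blk n)) (B : Blk n) :
    Q (l1 ++ B :: l2) ↔ (∀ A ∈ l1, A.Nonempty) ∧ B.Nonempty ∧ (∀ A ∈ l2, A.Nonempty) ∧
      (l1.Pairwise Disjoint ∧ l2.Pairwise Disjoint ∧
      Disjoint B (lUnion l2) ∧ Disjoint B (lUnion l1) ∧ Disjoint (lUnion l2) (lUnion l1)) ∧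
      ∃ b ∈ l1.headD B, ∀ a, (a ∈ lUnion l1 ∨ a ∈ B ∨ a ∈ lUnion l2) → b ≤ a := by
  unfold Q
  rw [pw_iff, lU_app, headD_app]
  simp only [Finset.mem_union, List.mem_append, List.mem_cons]
  constructor
  · rintro ⟨h1, h2, -, h4⟩
    exact ⟨fun A hA => h1 A (.inl hA), h1 B (.inr (.inl rfl)), fun A hA => h1 A (.inr (.inr hA)),
      h2, h4⟩
  · rintro ⟨h1, h2, h3, h4, h5⟩
    refine ⟨?_, h4, by simp, h5⟩
    rintro A (h | rfl | h)
    · exact h1 A h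
    · exact h2
    · exact h3 A h

theorem headD_sub {n : ℕ} (l1 : List (Blk n)) (B : Blk n) (x : Fin n) (h : x ∈ l1.headD B) :
    (l1 = [] ∧ x ∈ B) ∨ (l1 ≠ [] ∧ x ∈ lUnion l1) := by
  cases l1 with
  | nil => left; simpa using h
  | cons a t => right; exact ⟨by simp, (mem_lUnion _ _).2 ⟨a, by simp, by simpa using h⟩⟩

theorem headD_irrel {n : ℕ} (l1 : List (Blk n)) (B B' : Blk n) (h : l1 ≠ []) :
    l1.headD B = l1.headD B' := by
  cases l1 with
  | nil => exact absurd rfl h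
  | cons a t => rfl

section step
variable {n : ℕ} {U : Blk n} {e : Fin n} {l1 l2 : List (Blk n)} {b : Blk n}
  {F : Finset (List (Blk n))}

theorem join1 (he : ∀ a ∈ U, a < e) (h : IsPt U (l1, b, l2, F)) :
    e ∉ b ∧ IsPt (insert e U) (l1, insert e b, l2, F) := by
  obtain ⟨hQ, hU, hF⟩ := h
  simp only [IsPt, lst] at *
  rw [lU_app] at hU hF ⊢
  rw [Q_iff] at hQ ⊢
  have heU : e ∉ lUnion l1 ∪ (b ∪ lUnion l2) := fun h => lt_irrefl _ (he e (hU h))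
  simp only [Finset.mem_union, not_or] at heU
  have hun : lUnion l1 ∪ (insert e b ∪ lUnion l2) = insert e (lUnion l1 ∪ (b ∪ lUnion l2)) := by
    ext x; simp only [Finset.mem_union, Finset.mem_insert]; tauto
  refine ⟨heU.2.1, ?_, ?_, ?_⟩
  · obtain ⟨h1, h2, h3, ⟨h4, h5, h6, h7, h8⟩, c, hc, hmin⟩ := hQ
    refine ⟨h1, by simp, h3, ⟨h4, h5, ?_, ?_, h8⟩, c, ?_, ?_⟩
    · rw [Finset.disjoint_insert_left]; exact ⟨heU.2.2, h6⟩
    · rw [Finset.disjoint_insert_left]; exact ⟨heU.1, h7⟩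
    · cases l1 with
      | nil => simp only [List.headD_nil] at hc ⊢; exact Finset.mem_insert_of_mem hc
      | cons a t => exact hc
    · intro a ha
      by_cases hae : a = e
      · subst hae
        refine (he c (hU ?_)).le
        rcases headD_sub _ _ _ hc with h | h <;> simp [h.2]
      · apply hmin
        simpa [hae] using ha
  · rw [hun]; exact Finset.insert_subset_insert _ hU
  · rw [hun]
    convert hF using 1
    ext x
    have := he x
    simp only [Finset.mem_sdiff, Finset.mem_insert, not_or]
    constructor
    · rintro ⟨h1, h2, h3⟩; exact ⟨by tauto, h3⟩
    · rintro ⟨h1, h2⟩; exact ⟨.inr h1, (he x h1).ne, h2⟩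

theorem join2 (he : ∀ a ∈ U, a < e) (h : IsPt (insert e U) (l1, b, l2, F)) (heb : e ∈ b)
    (hb : b ≠ {e}) : IsPt U (l1, b.erase e, l2, F) := by
  obtain ⟨hQ, hU, hF⟩ := h
  simp only [IsPt, lst] at *
  rw [lU_app] at hU hF ⊢
  rw [Q_iff] at hQ ⊢
  obtain ⟨h1, h2, h3, ⟨h4, h5, h6, h7, h8⟩, c, hc, hmin⟩ := hQ
  have e1 : e ∉ lUnion l1 := Finset.disjoint_left.1 h7 heb
  have e2 : e ∉ lUnion l2 := Finset.disjoint_left.1 h6 heb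
  have hun : lUnion l1 ∪ (b.erase e ∪ lUnion l2) = (lUnion l1 ∪ (b ∪ lUnion l2)).erase e := by
    ext x; simp only [Finset.mem_union, Finset.mem_erase]
    by_cases hx : x = e
    · subst hx; tauto
    · tauto
  have hne : (b.erase e).Nonempty := by
    rw [Finset.nonempty_iff_ne_empty]
    intro h0
    rcases (Finset.erase_eq_empty_iff _ _).1 h0 with h | h
    · simp [h] at heb
    · exact hb h
  refine ⟨?_, ?_, ?_⟩
  · refine ⟨h1, hne, h3, ⟨h4, h5, h6.mono_left (Finset.erase_subset _ _),
      h7.mono_left (Finset.erase_subset _ _), h8⟩, c, ?_, ?_⟩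
    · cases l1 with
      | nil =>
        simp only [List.headD_nil] at hc ⊢
        refine Finset.mem_erase.2 ⟨?_, hc⟩
        rintro rfl
        obtain ⟨y, hy⟩ := hne
        have hy' := Finset.mem_erase.1 hy
        have h9 := hmin y (.inr (.inl hy'.2))
        have h10 : y ∈ insert c U := hU (by simp [hy'.2])
        rcases Finset.mem_insert.1 h10 with h | h
        · exact hy'.1 h
        · exact absurd (he y h) (not_lt.2 h9)
      | cons a t => exact hc
    · intro a ha
      apply hmin
      simp only [Finset.mem_erase] at ha
      tauto
  · rw [hun]
    intro x hx
    have hx' := Finset.mem_erase.1 hx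
    exact (Finset.mem_insert.1 (hU hx'.2)).resolve_left hx'.1
  · rw [hun]
    convert hF using 1
    ext x
    simp only [Finset.mem_sdiff, Finset.mem_insert, Finset.mem_erase, not_and]
    constructor
    · rintro ⟨h1, h2⟩; exact ⟨.inr h1, h2 (he x h1).ne⟩
    · rintro ⟨h1 | h1, h2⟩
      · subst h1; simp [heb] at h2
      · exact ⟨h1, fun _ => h2⟩

theorem after1 (he : ∀ a ∈ U, a < e) (h : IsPt U (l1, b, l2, F)) :
    IsPt (insert e U) (l1 ++ [b], {e}, l2, F) := by
  obtain ⟨hQ, hU, hF⟩ := h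
  simp only [IsPt, lst] at *
  rw [lU_app] at hU hF ⊢
  rw [Q_iff] at hQ ⊢
  rw [lU_snoc]
  have heU : e ∉ lUnion l1 ∪ (b ∪ lUnion l2) := fun h => lt_irrefl _ (he e (hU h))
  simp only [Finset.mem_union, not_or] at heU
  have hun : lUnion l1 ∪ b ∪ ({e} ∪ lUnion l2) = insert e (lUnion l1 ∪ (b ∪ lUnion l2)) := by
    ext x; simp only [Finset.mem_union, Finset.mem_insert, Finset.mem_singleton]; tauto
  refine ⟨?_, ?_, ?_⟩
  · obtain ⟨h1, h2, h3, ⟨h4, h5, h6, h7, h8⟩, c, hc, hmin⟩ := hQ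
    refine ⟨?_, by simp, h3, ⟨?_, h5, ?_, ?_, ?_⟩, c, ?_, ?_⟩
    · intro A hA
      rcases List.mem_append.1 hA with h | h
      · exact h1 A h
      · simp only [List.mem_singleton] at h; rw [h]; exact h2
    · have h0 : lUnion ([] : List (Blk n)) = ∅ := rfl
      rw [pw_iff]; simp [h4, h7, h0]
    · simpa using heU.2.2
    · simp [heU]
    · exact Finset.disjoint_union_right.2 ⟨h8, h6.symm⟩
    · rw [← headD_app l1 [] b] at hc
      cases l1 <;> exact hc
    · intro a ha
      by_cases hae : a = e
      · subst hae
        refine (he c (hU ?_)).le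
        rcases headD_sub _ _ _ hc with h | h <;> simp [h.2]
      · apply hmin
        simp only [Finset.mem_union, Finset.mem_singleton, hae] at ha
        tauto
  · rw [hun]; exact Finset.insert_subset_insert _ hU
  · rw [hun]
    convert hF using 1
    ext x
    simp only [Finset.mem_sdiff, Finset.mem_insert, not_or]
    constructor
    · rintro ⟨h1, h2, h3⟩; exact ⟨by tauto, h3⟩
    · rintro ⟨h1, h2⟩; exact ⟨.inr h1, (he x h1).ne, h2⟩

theorem after2 (he : ∀ a ∈ U, a < e) (h : IsPt (insert e U) (l1 ++ [b], {e}, l2, F)) :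
    IsPt U (l1, b, l2, F) := by
  obtain ⟨hQ, hU, hF⟩ := h
  simp only [IsPt, lst] at *
  rw [lU_app] at hU hF ⊢
  rw [Q_iff] at hQ ⊢
  rw [lU_snoc] at hQ hU hF
  obtain ⟨h1, h2, h3, ⟨h4, h5, h6, h7, h8⟩, c, hc, hmin⟩ := hQ
  have hun : lUnion l1 ∪ b ∪ ({e} ∪ lUnion l2) = insert e (lUnion l1 ∪ (b ∪ lUnion l2)) := by
    ext x; simp only [Finset.mem_union, Finset.mem_insert, Finset.mem_singleton]; tauto
  rw [hun] at hU hF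
  rw [pw_iff] at h4
  rw [Finset.disjoint_union_right] at h8
  have e1 : e ∉ lUnion l1 ∪ b := by simpa using h7
  have e2 : e ∉ lUnion l2 := by simpa using h6
  simp only [Finset.mem_union, not_or] at e1
  refine ⟨⟨fun A hA => h1 A (by simp [hA]), h1 b (by simp), h3,
    ⟨h4.1, h5, h8.2.symm, h4.2.2.2.1, h8.1⟩, c, ?_, ?_⟩, ?_, ?_⟩
  · cases l1 <;> exact hc
  · intro a ha
    apply hmin
    simp only [Finset.mem_union]
    tauto
  · intro x hx
    have h9 := hU (Finset.mem_insert_of_mem hx)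
    rcases Finset.mem_insert.1 h9 with h | h
    · subst h
      simp only [Finset.mem_union] at hx
      tauto
    · exact h
  · convert hF using 1
    ext x
    simp only [Finset.mem_sdiff, Finset.mem_insert, not_or]
    constructor
    · rintro ⟨h1, h2⟩; exact ⟨.inr h1, (he x h1).ne, h2⟩
    · rintro ⟨h1, h2, h3⟩; exact ⟨by tauto, h3⟩

theorem first (he : ∀ a ∈ U, a < e) (h : IsPt (insert e U) ([], {e}, l2, F)) : l2 = [] := by
  obtain ⟨hQ, hU, hF⟩ := h
  simp only [lst] at *
  rw [lU_app] at hU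
  rw [Q_iff] at hQ
  obtain ⟨h1, h2, h3, ⟨h4, h5, h6, h7, h8⟩, c, hc, hmin⟩ := hQ
  cases l2 with
  | nil => rfl
  | cons a t =>
    exfalso
    obtain ⟨y, hy⟩ := h3 a (by simp)
    have hy' : y ∈ lUnion (a :: t) := (mem_lUnion _ _).2 ⟨a, by simp, hy⟩
    simp only [List.headD_nil, Finset.mem_singleton] at hc
    have h9 := hmin y (.inr (.inr hy'))
    have h10 := hU (Finset.mem_union_right _ (Finset.mem_union_right _ hy'))
    rcases Finset.mem_insert.1 h10 with h | h
    · subst h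
      simp [hy'] at h6
    · exact absurd (he y h) (not_lt.2 (hc ▸ h9))

theorem alone (he : ∀ a ∈ U, a < e) :
    IsPt (insert e U) ([], {e}, [], F) ↔ Csp U F := by
  have heU : e ∉ U := fun h => lt_irrefl _ (he e h)
  have h1 : lUnion [({e} : Blk n)] = {e} := by simp [lUnion]
  have h2 : insert e U \ {e} = U := by
    rw [Finset.sdiff_singleton_eq_erase, Finset.erase_insert heU]
  simp only [IsPt, lst, List.nil_append, h1, h2]
  constructor
  · exact fun h => h.2.2
  · intro h
    refine ⟨?_, by simp, h⟩
    simp [Q, h1]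

end step

theorem step {n : ℕ} (U : Blk n) (e : Fin n) (he : ∀ a ∈ U, a < e) (g : ℕ → ℕ → ℕ) :
    ∑ F ∈ cspF (insert e U), g (nb F) F.card =
    ∑ G ∈ cspF U, (nb G * g (nb G) G.card + nb G * g (nb G + 1) G.card
      + g (nb G + 1) (G.card + 1)) := by
  rw [sum_point _ e (by simp) (fun F => g (nb F) F.card)]
  rw [Finset.sum_add_distrib, Finset.sum_add_distrib]
  rw [← sum_pt U (fun G => g (nb G) G.card), ← sum_pt U (fun G => g (nb G + 1) G.card)]
  rw [← Finset.sum_filter_add_sum_filter_not _ (fun p => p.2.1 ≠ {e}), add_assoc]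
  congr 1
  · symm
    refine Finset.sum_bij' (fun p _ => (p.1, insert e p.2.1, p.2.2))
      (fun p _ => (p.1, p.2.1.erase e, p.2.2)) ?_ ?_ ?_ ?_ ?_
    · rintro ⟨l1, b, l2, F⟩ h
      rw [mem_ptF] at h
      obtain ⟨h1, h2⟩ := join1 he h
      simp only [Finset.mem_filter, mem_ptF]
      refine ⟨⟨h2, by simp⟩, fun h3 => ?_⟩
      have h4 : b = ∅ := by rw [← Finset.erase_insert h1, h3]; simp
      have := h.1.1 b (by simp [lst])
      simp [h4] at this
    · rintro ⟨l1, b, l2, F⟩ h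
      simp only [Finset.mem_filter, mem_ptF] at h ⊢
      exact join2 he h.1.1 h.1.2 h.2
    · rintro ⟨l1, b, l2, F⟩ h
      rw [mem_ptF] at h
      obtain ⟨h1, h2⟩ := join1 he h
      simp [Finset.erase_insert h1]
    · rintro ⟨l1, b, l2, F⟩ h
      simp only [Finset.mem_filter, mem_ptF] at h
      simp [Finset.insert_erase h.1.2]
    · rintro ⟨l1, b, l2, F⟩ h
      rw [mem_ptF] at h
      obtain ⟨h1, h2⟩ := join1 he h
      rw [h.nb, h.card, h2.nb, h2.card]
  rw [← Finset.sum_filter_add_sum_filter_not _ (fun p => p.1 ≠ [])]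
  congr 1
  · symm
    refine Finset.sum_bij' (fun p _ => (p.1 ++ [p.2.1], {e}, p.2.2))
      (fun p _ => (p.1.dropLast, p.1.getLastD ∅, p.2.2)) ?_ ?_ ?_ ?_ ?_
    · rintro ⟨l1, b, l2, F⟩ h
      rw [mem_ptF] at h
      have h2 := after1 he h
      simp only [Finset.mem_filter, mem_ptF]
      exact ⟨⟨⟨h2, by simp⟩, by simp⟩, by simp⟩
    · rintro ⟨l1, b, l2, F⟩ h
      simp only [Finset.mem_filter, mem_ptF, not_not] at h ⊢
      obtain ⟨⟨⟨h1, h2⟩, rfl⟩, h4⟩ := h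
      rcases List.eq_nil_or_concat l1 with h | ⟨t, a, rfl⟩
      · exact absurd h h4
      · simp only [List.concat_eq_append] at h1 ⊢
        simpa using after2 he h1
    · rintro ⟨l1, b, l2, F⟩ h
      simp
    · rintro ⟨l1, b, l2, F⟩ h
      simp only [Finset.mem_filter, mem_ptF, not_not] at h ⊢
      obtain ⟨⟨⟨h1, h2⟩, rfl⟩, h4⟩ := h
      rcases List.eq_nil_or_concat l1 with h | ⟨t, a, rfl⟩
      · exact absurd h h4
      · simp
    · rintro ⟨l1, b, l2, F⟩ h
      rw [mem_ptF] at h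
      have h2 := after1 he h
      rw [h.nb, h.card, h2.nb, h2.card]
      congr 1
      simp; omega
  · symm
    refine Finset.sum_bij' (fun F _ => ([], {e}, [], F)) (fun p _ => p.2.2.2) ?_ ?_ ?_ ?_ ?_
    · intro F h
      rw [mem_cspF] at h
      simp only [Finset.mem_filter, mem_ptF]
      exact ⟨⟨⟨(alone he).2 h, by simp⟩, by simp⟩, by simp⟩
    · rintro ⟨l1, b, l2, F⟩ h
      simp only [Finset.mem_filter, mem_ptF, not_not] at h
      obtain ⟨⟨⟨h1, h2⟩, rfl⟩, rfl⟩ := h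
      obtain rfl := first he h1
      exact mem_cspF.2 ((alone he).1 h1)
    · intro F h; rfl
    · rintro ⟨l1, b, l2, F⟩ h
      simp only [Finset.mem_filter, mem_ptF, not_not] at h
      obtain ⟨⟨⟨h1, h2⟩, rfl⟩, rfl⟩ := h
      obtain rfl := first he h1
      rfl
    · intro F h
      rw [mem_cspF] at h
      have h2 := (alone he).2 h
      rw [h2.nb, h2.card]
      simp [add_comm]

/-- The initial segment of `Fin n`. -/
def J (n m : ℕ) : Blk n := Finset.univ.filter (fun x => x.val < m)

/-- Count with `i` blocks and `k` lists. -/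
noncomputable def A (n m i k : ℕ) : ℕ :=
  ∑ F ∈ cspF (J n m), if nb F = i ∧ F.card = k then 1 else 0

theorem A_zero (n i k : ℕ) : A n 0 i k = if i = 0 ∧ k = 0 then 1 else 0 := by
  have : cspF (J n 0) = {∅} := by
    ext F
    rw [mem_cspF, Finset.mem_singleton]
    have hJ : J n 0 = ∅ := by simp [J]
    constructor
    · rintro ⟨h1, h2, h3⟩
      rw [Finset.eq_empty_iff_forall_notMem]
      intro M hM
      obtain ⟨x, hx⟩ := (h1 M hM).lne
      have : x ∈ J n 0 := by rw [← h3]; exact Finset.mem_sup.2 ⟨M, hM, hx⟩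
      simp [hJ] at this
    · rintro rfl
      exact ⟨by simp, by simp, by simp [hJ]⟩
  rw [A, this, Finset.sum_singleton]
  simp [nb, eq_comm]

theorem A_rec (n m : ℕ) (hm : m < n) (i k : ℕ) : A n (m + 1) i k =
    i * A n m i k + ∑ G ∈ cspF (J n m), ((if nb G + 1 = i ∧ G.card = k then nb G else 0) +
      (if nb G + 1 = i ∧ G.card + 1 = k then 1 else 0)) := by
  have hJ : J n (m + 1) = insert ⟨m, hm⟩ (J n m) := by
    ext x
    simp [J, Fin.ext_iff]; omega
  unfold A
  rw [hJ, step _ _ (by simp [J, Fin.lt_def]) (fun a b => if a = i ∧ b = k then 1 else 0)]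
  rw [Finset.mul_sum, ← Finset.sum_add_distrib]
  refine Finset.sum_congr rfl fun G _ => ?_
  rw [add_assoc]
  congr 1
  · split_ifs with h
    · rw [h.1]
    · simp
  · simp

theorem A_eq (n m : ℕ) (hm : m ≤ n) (i k : ℕ) : A n m i k = stirling2 m i * stirling1 i k := by
  induction m generalizing i k with
  | zero =>
    rw [A_zero]
    cases i <;> cases k <;> simp [stirling2, stirling1]
  | succ m ih =>
    have ih := ih (by omega)
    rw [A_rec n m (by omega)]
    cases i with
    | zero => simp [stirling2]
    | succ i =>
      have h1 : ∑ G ∈ cspF (J n m), (if nb G + 1 = i + 1 ∧ G.card = k then nb G else 0)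
          = i * A n m i k := by
        unfold A
        rw [Finset.mul_sum]
        refine Finset.sum_congr rfl fun G _ => ?_
        by_cases h : nb G = i <;> simp [h]
      rw [Finset.sum_add_distrib, h1, ih, ih]
      cases k with
      | zero =>
        cases i <;> simp [stirling1]
      | succ k =>
        have h2 : ∑ G ∈ cspF (J n m), (if nb G + 1 = i + 1 ∧ G.card + 1 = k + 1 then 1 else 0)
            = A n m i k := by
          unfold A
          refine Finset.sum_congr rfl fun G _ => ?_
          simp
        rw [h2, ih]
        simp only [stirling2, stirling1]
        ring

theorem stirling2_lt (n : ℕ) : ∀ k, n < k → stirling2 n k = 0 := by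
  induction n with
  | zero => intro k hk; cases k with
    | zero => omega
    | succ k => rfl
  | succ n ih => intro k hk; cases k with
    | zero => omega
    | succ k => simp [stirling2, ih (k + 1) (by omega), ih k (by omega)]

theorem stirling1_lt (n : ℕ) : ∀ k, n < k → stirling1 n k = 0 := by
  induction n with
  | zero => intro k hk; cases k with
    | zero => omega
    | succ k => rfl
  | succ n ih => intro k hk; cases k with
    | zero => omega
    | succ k => simp [stirling1, ih (k + 1) (by omega), ih k (by omega)]

/-- For `1 ≤ k ≤ n`, the number of standard composite set partitions of
`{1,…,n}` consisting of exactly `k` ordered set partitions is `∑_{i=k}^n S(n,i)·s(i,k)`. -/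
theorem statement_10 (n k : ℕ) (h1 : 1 ≤ k) (h2 : k ≤ n) :
    Nat.card {F : Finset (List (Finset (Fin n))) // IsStdCSP n F ∧ F.card = k} =
    ∑ i ∈ Finset.Icc k n, stirling2 n i * stirling1 i k := by
  have hJ : J n n = Finset.univ := by ext x; simp [J]
  have hA : ∀ i, (((cspF (J n n)).filter (fun F => F.card = k)).filter (fun F => nb F = i)).card
      = stirling2 n i * stirling1 i k := by
    intro i
    rw [← A_eq n n le_rfl, A, Finset.filter_filter, Finset.card_filter]
    simp only [and_comm]
  have h0 : Nat.card {F : Finset (List (Finset (Fin n))) // IsStdCSP n F ∧ F.card = k} =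
      ((cspF (J n n)).filter (fun F => F.card = k)).card := by
    refine Nat.subtype_card _ ?_
    intro F
    rw [Finset.mem_filter, mem_cspF, csp_iff, hJ]
  rw [h0, Finset.card_eq_sum_card_fiberwise (f := nb) (t := Finset.Icc k n)]
  · exact Finset.sum_congr rfl fun i _ => hA i
  · intro F hF
    by_contra hcon
    have h3 := hA (nb F)
    have h4 : stirling2 n (nb F) * stirling1 (nb F) k = 0 := by
      simp only [Finset.coe_Icc, Set.mem_Icc, not_and_or, not_le] at hcon
      rcases hcon with h | h
      · rw [stirling1_lt _ _ h, mul_zero]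
      · rw [stirling2_lt _ _ h, zero_mul]
    rw [h4, Finset.card_eq_zero] at h3
    have : F ∈ ({} : Finset (Finset (List (Finset (Fin n))))) := by
      rw [← h3]; exact Finset.mem_filter.2 ⟨hF, rfl⟩
    simp at this

end PlatesPaper
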